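/- Each of the three functions I₀₁, I₀₂, I₀₃ Poisson commutes with the Smorodinsky–Winternitz Hamiltonian H^SW at every point of D: {I₀₁, H^SW} = {I₀₂, H^SW} = {I₀₃, H^SW} = 0. -/

import Mathlib

namespace Paper
noncomputable section

/-- The κ-dependent cosine Cκ(x) = ∑ (−κ)^l x^{2l}/(2l)!. -/
def Ck (κ x : ℝ) : ℝ := ∑' l : ℕ, (-κ) ^ l * x ^ (2 * l) / (Nat.factorial (2 * l) : ℝ)

/-- The κ-dependent sine Sκ(x) = ∑ (−κ)^l x^{2l+1}/(2l+1)!. -/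
def Sk (κ x : ℝ) : ℝ := ∑' l : ℕ, (-κ) ^ l * x ^ (2 * l + 1) / (Nat.factorial (2 * l + 1) : ℝ)

/-- The κ-dependent tangent Tκ(x) = Sκ(x)/Cκ(x). -/
def Tk (κ x : ℝ) : ℝ := Sk κ x / Ck κ x

/-- Phase space ℝ³ × ℝ³ ≃ ℝ⁶ with canonical coordinates
`(r, θ, φ, p_r, p_θ, p_φ) = (x 0, x 1, x 2, x 3, x 4, x 5)`. -/
abbrev Pt := Fin 6 → ℝ

/-- Partial derivative in the i-th coordinate direction. -/
def pd (f : Pt → ℝ) (i : Fin 6) (x : Pt) : ℝ := fderiv ℝ f x (Pi.single i 1)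

/-- Canonical Poisson bracket {f,g} = ∑_{q} (∂f/∂q ∂g/∂p_q − ∂g/∂q ∂f/∂p_q). -/
def pb (f g : Pt → ℝ) (x : Pt) : ℝ :=
  ∑ i : Fin 3,
    (pd f ⟨i.1, by omega⟩ x * pd g ⟨i.1 + 3, by omega⟩ x
      - pd g ⟨i.1, by omega⟩ x * pd f ⟨i.1 + 3, by omega⟩ x)

/-- Gradient of a function on phase space, as a vector in ℝ⁶. -/
def grad (f : Pt → ℝ) (x : Pt) : Fin 6 → ℝ := fun i => pd f i x

/-- The open domain D where Sκ₁(r), Cκ₁(r), Sκ₂(θ), Cκ₂(θ), cos φ, sin φ are nonzero. -/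
def D (κ₁ κ₂ : ℝ) : Set Pt :=
  {x | Sk κ₁ (x 0) ≠ 0 ∧ Ck κ₁ (x 0) ≠ 0 ∧ Sk κ₂ (x 1) ≠ 0 ∧ Ck κ₂ (x 1) ≠ 0 ∧
       Real.cos (x 2) ≠ 0 ∧ Real.sin (x 2) ≠ 0}

/-- J₀₁ = Cκ₂(θ)p_r − (Sκ₂(θ)/Tκ₁(r))p_θ. -/
def J01 (κ₁ κ₂ : ℝ) (x : Pt) : ℝ :=
  Ck κ₂ (x 1) * x 3 - (Sk κ₂ (x 1) / Tk κ₁ (x 0)) * x 4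

/-- J₀₂. -/
def J02 (κ₁ κ₂ : ℝ) (x : Pt) : ℝ :=
  κ₂ * Sk κ₂ (x 1) * Real.cos (x 2) * x 3
    + (Ck κ₂ (x 1) * Real.cos (x 2) / Tk κ₁ (x 0)) * x 4
    - (Real.sin (x 2) / (Tk κ₁ (x 0) * Sk κ₂ (x 1))) * x 5

/-- J₀₃. -/
def J03 (κ₁ κ₂ : ℝ) (x : Pt) : ℝ :=
  κ₂ * Sk κ₂ (x 1) * Real.sin (x 2) * x 3
    + (Ck κ₂ (x 1) * Real.sin (x 2) / Tk κ₁ (x 0)) * x 4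
    + (Real.cos (x 2) / (Tk κ₁ (x 0) * Sk κ₂ (x 1))) * x 5

/-- J₁₂ = cos φ·p_θ − (sin φ/Tκ₂(θ))p_φ. -/
def J12 (κ₂ : ℝ) (x : Pt) : ℝ :=
  Real.cos (x 2) * x 4 - (Real.sin (x 2) / Tk κ₂ (x 1)) * x 5

/-- J₁₃ = sin φ·p_θ + (cos φ/Tκ₂(θ))p_φ. -/
def J13 (κ₂ : ℝ) (x : Pt) : ℝ :=
  Real.sin (x 2) * x 4 + (Real.cos (x 2) / Tk κ₂ (x 1)) * x 5

/-- J₂₃ = p_φ. -/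
def J23 (x : Pt) : ℝ := x 5

/-- Kinetic energy T. -/
def Tkin (κ₁ κ₂ : ℝ) (x : Pt) : ℝ :=
  (1 / 2) * ((x 3) ^ 2 + (x 4) ^ 2 / (κ₂ * Sk κ₁ (x 0) ^ 2)
    + (x 5) ^ 2 / (κ₂ * Sk κ₁ (x 0) ^ 2 * Sk κ₂ (x 1) ^ 2))

/-- The superintegrable potential U with arbitrary radial function F. -/
def U (κ₁ κ₂ : ℝ) (F : ℝ → ℝ) (β₁ β₂ β₃ : ℝ) (x : Pt) : ℝ :=
  F (x 0) + (1 / Sk κ₁ (x 0) ^ 2) *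
    (β₁ / Ck κ₂ (x 1) ^ 2 + β₂ / (Sk κ₂ (x 1) ^ 2 * Real.cos (x 2) ^ 2)
      + β₃ / (Sk κ₂ (x 1) ^ 2 * Real.sin (x 2) ^ 2))

/-- Integral I₁₂. -/
def I12 (κ₂ β₁ β₂ : ℝ) (x : Pt) : ℝ :=
  (Real.cos (x 2) * x 4 - (Real.sin (x 2) / Tk κ₂ (x 1)) * x 5) ^ 2
    + 2 * β₁ * κ₂ ^ 2 * Tk κ₂ (x 1) ^ 2 * Real.cos (x 2) ^ 2
    + 2 * β₂ * κ₂ / (Tk κ₂ (x 1) ^ 2 * Real.cos (x 2) ^ 2)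

/-- Integral I₁₃. -/
def I13 (κ₂ β₁ β₃ : ℝ) (x : Pt) : ℝ :=
  (Real.sin (x 2) * x 4 + (Real.cos (x 2) / Tk κ₂ (x 1)) * x 5) ^ 2
    + 2 * β₁ * κ₂ ^ 2 * Tk κ₂ (x 1) ^ 2 * Real.sin (x 2) ^ 2
    + 2 * β₃ * κ₂ / (Tk κ₂ (x 1) ^ 2 * Real.sin (x 2) ^ 2)

/-- Integral I₂₃. -/
def I23 (κ₂ β₂ β₃ : ℝ) (x : Pt) : ℝ :=
  (x 5) ^ 2 + 2 * β₂ * κ₂ * Real.tan (x 2) ^ 2 + 2 * β₃ * κ₂ / Real.tan (x 2) ^ 2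

/-- Integral I₁₂₃. -/
def I123 (κ₂ β₁ β₂ β₃ : ℝ) (x : Pt) : ℝ :=
  (x 4) ^ 2 + (x 5) ^ 2 / Sk κ₂ (x 1) ^ 2 + 2 * β₁ * κ₂ / Ck κ₂ (x 1) ^ 2
    + 2 * β₂ * κ₂ / (Sk κ₂ (x 1) ^ 2 * Real.cos (x 2) ^ 2)
    + 2 * β₃ * κ₂ / (Sk κ₂ (x 1) ^ 2 * Real.sin (x 2) ^ 2)

/-- The Smorodinsky–Winternitz Hamiltonian H^SW. -/
def HSW (κ₁ κ₂ β₀ β₁ β₂ β₃ : ℝ) (x : Pt) : ℝ :=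
  Tkin κ₁ κ₂ x + β₀ * Tk κ₁ (x 0) ^ 2 + (1 / Sk κ₁ (x 0) ^ 2) *
    (β₁ / Ck κ₂ (x 1) ^ 2 + β₂ / (Sk κ₂ (x 1) ^ 2 * Real.cos (x 2) ^ 2)
      + β₃ / (Sk κ₂ (x 1) ^ 2 * Real.sin (x 2) ^ 2))

/-- Integral I₀₁ of H^SW. -/
def I01 (κ₁ κ₂ β₀ β₁ : ℝ) (x : Pt) : ℝ :=
  J01 κ₁ κ₂ x ^ 2 + 2 * β₀ * Tk κ₁ (x 0) ^ 2 * Ck κ₂ (x 1) ^ 2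
    + 2 * β₁ / (Tk κ₁ (x 0) ^ 2 * Ck κ₂ (x 1) ^ 2)

/-- Integral I₀₂ of H^SW. -/
def I02 (κ₁ κ₂ β₀ β₂ : ℝ) (x : Pt) : ℝ :=
  J02 κ₁ κ₂ x ^ 2 + 2 * β₀ * κ₂ ^ 2 * Tk κ₁ (x 0) ^ 2 * Sk κ₂ (x 1) ^ 2 * Real.cos (x 2) ^ 2
    + 2 * β₂ * κ₂ / (Tk κ₁ (x 0) ^ 2 * Sk κ₂ (x 1) ^ 2 * Real.cos (x 2) ^ 2)

/-- Integral I₀₃ of H^SW. -/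
def I03 (κ₁ κ₂ β₀ β₃ : ℝ) (x : Pt) : ℝ :=
  J03 κ₁ κ₂ x ^ 2 + 2 * β₀ * κ₂ ^ 2 * Tk κ₁ (x 0) ^ 2 * Sk κ₂ (x 1) ^ 2 * Real.sin (x 2) ^ 2
    + 2 * β₃ * κ₂ / (Tk κ₁ (x 0) ^ 2 * Sk κ₂ (x 1) ^ 2 * Real.sin (x 2) ^ 2)

/-- Generalized Kepler–Coulomb Hamiltonian H^GKC₁ = T + U^GKC₁. -/
def HGKC1 (κ₁ κ₂ k β₂ β₃ : ℝ) (x : Pt) : ℝ :=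
  Tkin κ₁ κ₂ x - k / Tk κ₁ (x 0)
    + (1 / (Sk κ₁ (x 0) ^ 2 * Sk κ₂ (x 1) ^ 2)) *
        (β₂ / Real.cos (x 2) ^ 2 + β₃ / Real.sin (x 2) ^ 2)

/-- Generalized Kepler–Coulomb Hamiltonian H^GKC₂ = T + U^GKC₂. -/
def HGKC2 (κ₁ κ₂ k β₁ β₃ : ℝ) (x : Pt) : ℝ :=
  Tkin κ₁ κ₂ x - k / Tk κ₁ (x 0)
    + (1 / Sk κ₁ (x 0) ^ 2) *
        (β₁ / Ck κ₂ (x 1) ^ 2 + β₃ / (Sk κ₂ (x 1) ^ 2 * Real.sin (x 2) ^ 2))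

/-- Generalized Kepler–Coulomb Hamiltonian H^GKC₃ = T + U^GKC₃. -/
def HGKC3 (κ₁ κ₂ k β₁ β₂ : ℝ) (x : Pt) : ℝ :=
  Tkin κ₁ κ₂ x - k / Tk κ₁ (x 0)
    + (1 / Sk κ₁ (x 0) ^ 2) *
        (β₁ / Ck κ₂ (x 1) ^ 2 + β₂ / (Sk κ₂ (x 1) ^ 2 * Real.cos (x 2) ^ 2))

/-- The function L₁. -/
def L1 (κ₁ κ₂ k β₂ β₃ : ℝ) (x : Pt) : ℝ :=
  -(J02 κ₁ κ₂ x * J12 κ₂ x) - J03 κ₁ κ₂ x * J13 κ₂ x + k * κ₂ * Ck κ₂ (x 1)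
    - (2 * κ₂ * Ck κ₂ (x 1) / (Tk κ₁ (x 0) * Sk κ₂ (x 1) ^ 2)) *
        (β₂ / Real.cos (x 2) ^ 2 + β₃ / Real.sin (x 2) ^ 2)

/-- The function L₂. -/
def L2 (κ₁ κ₂ k β₁ β₃ : ℝ) (x : Pt) : ℝ :=
  J01 κ₁ κ₂ x * J12 κ₂ x - J03 κ₁ κ₂ x * J23 x + k * κ₂ * Sk κ₂ (x 1) * Real.cos (x 2)
    - (2 * κ₂ * Real.cos (x 2) / Tk κ₁ (x 0)) *
        (β₁ * Sk κ₂ (x 1) / Ck κ₂ (x 1) ^ 2 + β₃ / (Sk κ₂ (x 1) * Real.sin (x 2) ^ 2))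

/-- The function L₃. -/
def L3 (κ₁ κ₂ k β₁ β₂ : ℝ) (x : Pt) : ℝ :=
  J01 κ₁ κ₂ x * J13 κ₂ x + J02 κ₁ κ₂ x * J23 x + k * κ₂ * Sk κ₂ (x 1) * Real.sin (x 2)
    - (2 * κ₂ * Real.sin (x 2) / Tk κ₁ (x 0)) *
        (β₁ * Sk κ₂ (x 1) / Ck κ₂ (x 1) ^ 2 + β₂ / (Sk κ₂ (x 1) * Real.cos (x 2) ^ 2))

lemma Ck_zero_left (x : ℝ) : Ck 0 x = 1 := by
  rw [Ck, tsum_eq_single 0 (fun l hl => by simp [hl])]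
  simp

lemma Sk_zero_left (x : ℝ) : Sk 0 x = x := by
  rw [Sk, tsum_eq_single 0 (fun l hl => by simp [hl])]
  simp

lemma Ck_sq (a x : ℝ) : Ck (a ^ 2) x = Real.cos (a * x) := by
  rw [Ck, ← (Real.hasSum_cos (a * x)).tsum_eq]
  refine tsum_congr fun l => ?_
  rw [neg_pow, mul_pow, pow_mul a, mul_assoc]

lemma Sk_sq {a : ℝ} (ha : a ≠ 0) (x : ℝ) : Sk (a ^ 2) x = Real.sin (a * x) / a := by
  rw [Sk, ← ((Real.hasSum_sin (a * x)).div_const a).tsum_eq]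
  refine tsum_congr fun l => ?_
  rw [neg_pow, mul_pow, pow_succ a (2 * l), pow_mul a]
  field_simp

lemma Ck_neg_sq (a x : ℝ) : Ck (-a ^ 2) x = Real.cosh (a * x) := by
  rw [Ck, ← (Real.hasSum_cosh (a * x)).tsum_eq]
  refine tsum_congr fun l => ?_
  rw [neg_neg, mul_pow, pow_mul a]

lemma Sk_neg_sq {a : ℝ} (ha : a ≠ 0) (x : ℝ) : Sk (-a ^ 2) x = Real.sinh (a * x) / a := by
  rw [Sk, ← ((Real.hasSum_sinh (a * x)).div_const a).tsum_eq]
  refine tsum_congr fun l => ?_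
  rw [neg_neg, mul_pow, pow_succ a (2 * l), pow_mul a]
  field_simp

/-- Every real number is zero, a nonzero square or minus a nonzero square. -/
lemma eq_zero_or_sq_or_neg_sq (κ : ℝ) :
    κ = 0 ∨ (∃ a : ℝ, a ≠ 0 ∧ κ = a ^ 2) ∨ ∃ a : ℝ, a ≠ 0 ∧ κ = -a ^ 2 := by
  rcases lt_trichotomy κ 0 with h | h | h
  · exact .inr (.inr ⟨√(-κ), (Real.sqrt_pos.2 (by linarith)).ne', by rw [Real.sq_sqrt (by linarith), neg_neg]⟩)
  · exact .inl h
  · exact .inr (.inl ⟨√κ, by positivity, (Real.sq_sqrt h.le).symm⟩)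

lemma Ck_sq_add_Sk_sq (κ x : ℝ) : Ck κ x ^ 2 + κ * Sk κ x ^ 2 = 1 := by
  rcases eq_zero_or_sq_or_neg_sq κ with rfl | ⟨a, ha, rfl⟩ | ⟨a, ha, rfl⟩
  · simp [Ck_zero_left]
  · rw [Ck_sq, Sk_sq ha]
    field_simp
    exact Real.cos_sq_add_sin_sq _
  · rw [Ck_neg_sq, Sk_neg_sq ha]
    field_simp
    linarith [Real.cosh_sq (a * x)]

lemma hasDerivAt_Ck (κ x : ℝ) : HasDerivAt (Ck κ) (-κ * Sk κ x) x := by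
  rcases eq_zero_or_sq_or_neg_sq κ with rfl | ⟨a, ha, rfl⟩ | ⟨a, ha, rfl⟩
  · rw [funext Ck_zero_left]
    simpa using hasDerivAt_const x (1 : ℝ)
  · rw [funext (Ck_sq a), Sk_sq ha]
    refine ((hasDerivAt_id' x).const_mul a).cos.congr_deriv ?_
    field_simp
  · rw [funext (Ck_neg_sq a), Sk_neg_sq ha]
    refine ((hasDerivAt_id' x).const_mul a).cosh.congr_deriv ?_
    field_simp

lemma hasDerivAt_Sk (κ x : ℝ) : HasDerivAt (Sk κ) (Ck κ x) x := by
  rcases eq_zero_or_sq_or_neg_sq κ with rfl | ⟨a, ha, rfl⟩ | ⟨a, ha, rfl⟩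
  · rw [funext Sk_zero_left, Ck_zero_left]
    exact hasDerivAt_id' x
  · rw [funext (Sk_sq ha), Ck_sq]
    refine (((hasDerivAt_id' x).const_mul a).sin.div_const a).congr_deriv ?_
    field_simp
  · rw [funext (Sk_neg_sq ha), Ck_neg_sq]
    refine (((hasDerivAt_id' x).const_mul a).sinh.div_const a).congr_deriv ?_
    field_simp

lemma hasDerivAt_Tk {κ x : ℝ} (h : Ck κ x ≠ 0) : HasDerivAt (Tk κ) (1 / Ck κ x ^ 2) x := by
  refine ((hasDerivAt_Sk κ x).div (hasDerivAt_Ck κ x) h).congr_deriv ?_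
  rw [← Ck_sq_add_Sk_sq κ x]
  ring

/-- `f` is differentiable at `x` with derivative `d` in the direction `v`. -/
def HasDirDerivAt (f : Pt → ℝ) (d : ℝ) (x v : Pt) : Prop :=
  DifferentiableAt ℝ f x ∧ fderiv ℝ f x v = d

namespace HasDirDerivAt

variable {f g : Pt → ℝ} {d e : ℝ} {x v : Pt}

lemma pd_eq {i : Fin 6} (h : HasDirDerivAt f d x (Pi.single i 1)) : pd f i x = d := h.2

lemma const (c : ℝ) (x v : Pt) : HasDirDerivAt (fun _ => c) 0 x v :=
  ⟨differentiableAt_const c, by simp⟩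

lemma coord (i : Fin 6) (x v : Pt) : HasDirDerivAt (fun y => y i) (v i) x v :=
  ⟨by fun_prop, by simp [(hasFDerivAt_apply (𝕜 := ℝ) i x).fderiv]⟩

lemma comp {h : ℝ → ℝ} {h' : ℝ} (hh : HasDerivAt h h' (f x)) (hf : HasDirDerivAt f d x v) :
    HasDirDerivAt (fun y => h (f y)) (h' * d) x v := by
  have := hh.comp_hasFDerivAt x hf.1.hasFDerivAt
  exact ⟨this.differentiableAt, by
    rw [show fderiv ℝ (fun y => h (f y)) x = _ from this.fderiv, ← hf.2]; rfl⟩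

lemma add (hf : HasDirDerivAt f d x v) (hg : HasDirDerivAt g e x v) :
    HasDirDerivAt (fun y => f y + g y) (d + e) x v :=
  ⟨hf.1.add hg.1, by rw [fderiv_fun_add hf.1 hg.1, ← hf.2, ← hg.2]; rfl⟩

lemma sub (hf : HasDirDerivAt f d x v) (hg : HasDirDerivAt g e x v) :
    HasDirDerivAt (fun y => f y - g y) (d - e) x v :=
  ⟨hf.1.sub hg.1, by rw [fderiv_fun_sub hf.1 hg.1, ← hf.2, ← hg.2]; rfl⟩

lemma mul (hf : HasDirDerivAt f d x v) (hg : HasDirDerivAt g e x v) :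
    HasDirDerivAt (fun y => f y * g y) (d * g x + f x * e) x v :=
  ⟨hf.1.mul hg.1, by
    rw [fderiv_fun_mul hf.1 hg.1, ← hf.2, ← hg.2]
    simp only [add_apply, smul_apply, smul_eq_mul]
    ring⟩

lemma const_mul (c : ℝ) (hf : HasDirDerivAt f d x v) :
    HasDirDerivAt (fun y => c * f y) (c * d) x v := by
  simpa using (const c x v).mul hf

lemma sq (hf : HasDirDerivAt f d x v) :
    HasDirDerivAt (fun y => f y ^ 2) (2 * f x * d) x v := by
  simpa using comp (hasDerivAt_pow 2 (f x)) hf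

lemma inv (hf : HasDirDerivAt f d x v) (h0 : f x ≠ 0) :
    HasDirDerivAt (fun y => (f y)⁻¹) (-(f x ^ 2)⁻¹ * d) x v :=
  comp (hasDerivAt_inv h0) hf

lemma congr_deriv (hf : HasDirDerivAt f d x v) (h : d = e) : HasDirDerivAt f e x v := h ▸ hf

lemma div (hf : HasDirDerivAt f d x v) (hg : HasDirDerivAt g e x v) (h0 : g x ≠ 0) :
    HasDirDerivAt (fun y => f y / g y) (d / g x - f x * e / g x ^ 2) x v := by
  have := hf.mul (hg.inv h0)
  simp only [← div_eq_mul_inv] at this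
  refine ⟨this.1, this.2.trans ?_⟩
  ring

end HasDirDerivAt

section partials

variable {κ₁ κ₂ : ℝ} {x : Pt}

lemma hasDirDerivAt_Tk_fst (hC : Ck κ₁ (x 0) ≠ 0) (v : Pt) :
    HasDirDerivAt (fun y => Tk κ₁ (y 0)) (1 / Ck κ₁ (x 0) ^ 2 * v 0) x v :=
  .comp (f := fun y => y 0) (hasDerivAt_Tk hC) (.coord 0 x v)

lemma hasDirDerivAt_Ck (κ : ℝ) (i : Fin 6) (x v : Pt) :
    HasDirDerivAt (fun y => Ck κ (y i)) (-κ * Sk κ (x i) * v i) x v :=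
  .comp (f := fun y => y i) (hasDerivAt_Ck κ (x i)) (.coord i x v)

lemma hasDirDerivAt_Sk (κ : ℝ) (i : Fin 6) (x v : Pt) :
    HasDirDerivAt (fun y => Sk κ (y i)) (Ck κ (x i) * v i) x v :=
  .comp (f := fun y => y i) (hasDerivAt_Sk κ (x i)) (.coord i x v)

lemma hasDirDerivAt_cos (i : Fin 6) (x v : Pt) :
    HasDirDerivAt (fun y => Real.cos (y i)) (-Real.sin (x i) * v i) x v :=
  .comp (f := fun y => y i) (Real.hasDerivAt_cos (x i)) (.coord i x v)

lemma hasDirDerivAt_sin (i : Fin 6) (x v : Pt) :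
    HasDirDerivAt (fun y => Real.sin (y i)) (Real.cos (x i) * v i) x v :=
  .comp (f := fun y => y i) (Real.hasDerivAt_sin (x i)) (.coord i x v)

lemma hasDirDerivAt_J01 (hx : x ∈ D κ₁ κ₂) (v : Pt) :
    HasDirDerivAt (J01 κ₁ κ₂)
      (-κ₂ * Sk κ₂ (x 1) * x 3 * v 1 + Ck κ₂ (x 1) * v 3
        - Ck κ₂ (x 1) * Ck κ₁ (x 0) / Sk κ₁ (x 0) * x 4 * v 1
        + Sk κ₂ (x 1) / Sk κ₁ (x 0) ^ 2 * x 4 * v 0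
        - Sk κ₂ (x 1) * Ck κ₁ (x 0) / Sk κ₁ (x 0) * v 4) x v := by
  obtain ⟨hS₁, hC₁, -⟩ := hx
  have hT : Tk κ₁ (x 0) ≠ 0 := div_ne_zero hS₁ hC₁
  refine (((hasDirDerivAt_Ck κ₂ 1 x v).mul (.coord 3 x v)).sub
    (((hasDirDerivAt_Sk κ₂ 1 x v).div (hasDirDerivAt_Tk_fst hC₁ v) hT).mul
      (.coord 4 x v))).congr_deriv ?_
  simp only [Tk]
  field_simp
  ring

lemma hasDirDerivAt_J02 (hx : x ∈ D κ₁ κ₂) (v : Pt) :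
    HasDirDerivAt (J02 κ₁ κ₂)
      (κ₂ * Ck κ₂ (x 1) * Real.cos (x 2) * x 3 * v 1 - κ₂ * Sk κ₂ (x 1) * Real.sin (x 2) * x 3 * v 2
        + κ₂ * Sk κ₂ (x 1) * Real.cos (x 2) * v 3
        - κ₂ * Sk κ₂ (x 1) * Real.cos (x 2) * Ck κ₁ (x 0) / Sk κ₁ (x 0) * x 4 * v 1
        - Ck κ₂ (x 1) * Real.sin (x 2) * Ck κ₁ (x 0) / Sk κ₁ (x 0) * x 4 * v 2
        - Ck κ₂ (x 1) * Real.cos (x 2) / Sk κ₁ (x 0) ^ 2 * x 4 * v 0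
        + Ck κ₂ (x 1) * Real.cos (x 2) * Ck κ₁ (x 0) / Sk κ₁ (x 0) * v 4
        - Real.cos (x 2) * Ck κ₁ (x 0) / (Sk κ₁ (x 0) * Sk κ₂ (x 1)) * x 5 * v 2
        + Real.sin (x 2) / (Sk κ₁ (x 0) ^ 2 * Sk κ₂ (x 1)) * x 5 * v 0
        + Real.sin (x 2) * Ck κ₁ (x 0) * Ck κ₂ (x 1) / (Sk κ₁ (x 0) * Sk κ₂ (x 1) ^ 2) * x 5 * v 1
        - Real.sin (x 2) * Ck κ₁ (x 0) / (Sk κ₁ (x 0) * Sk κ₂ (x 1)) * v 5) x v := by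
  obtain ⟨hS₁, hC₁, hS₂, -⟩ := hx
  have hT : Tk κ₁ (x 0) ≠ 0 := div_ne_zero hS₁ hC₁
  refine ((((((hasDirDerivAt_Sk κ₂ 1 x v).const_mul κ₂).mul (hasDirDerivAt_cos 2 x v)).mul
      (.coord 3 x v)).add
    ((((hasDirDerivAt_Ck κ₂ 1 x v).mul (hasDirDerivAt_cos 2 x v)).div
      (hasDirDerivAt_Tk_fst hC₁ v) hT).mul (.coord 4 x v))).sub
    (((hasDirDerivAt_sin 2 x v).div
      ((hasDirDerivAt_Tk_fst hC₁ v).mul (hasDirDerivAt_Sk κ₂ 1 x v)) (mul_ne_zero hT hS₂)).mul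
      (.coord 5 x v))).congr_deriv ?_
  simp only [Tk]
  field_simp
  ring

lemma hasDirDerivAt_J03 (hx : x ∈ D κ₁ κ₂) (v : Pt) :
    HasDirDerivAt (J03 κ₁ κ₂)
      (κ₂ * Ck κ₂ (x 1) * Real.sin (x 2) * x 3 * v 1 + κ₂ * Sk κ₂ (x 1) * Real.cos (x 2) * x 3 * v 2
        + κ₂ * Sk κ₂ (x 1) * Real.sin (x 2) * v 3
        - κ₂ * Sk κ₂ (x 1) * Real.sin (x 2) * Ck κ₁ (x 0) / Sk κ₁ (x 0) * x 4 * v 1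
        + Ck κ₂ (x 1) * Real.cos (x 2) * Ck κ₁ (x 0) / Sk κ₁ (x 0) * x 4 * v 2
        - Ck κ₂ (x 1) * Real.sin (x 2) / Sk κ₁ (x 0) ^ 2 * x 4 * v 0
        + Ck κ₂ (x 1) * Real.sin (x 2) * Ck κ₁ (x 0) / Sk κ₁ (x 0) * v 4
        - Real.sin (x 2) * Ck κ₁ (x 0) / (Sk κ₁ (x 0) * Sk κ₂ (x 1)) * x 5 * v 2
        - Real.cos (x 2) / (Sk κ₁ (x 0) ^ 2 * Sk κ₂ (x 1)) * x 5 * v 0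
        - Real.cos (x 2) * Ck κ₁ (x 0) * Ck κ₂ (x 1) / (Sk κ₁ (x 0) * Sk κ₂ (x 1) ^ 2) * x 5 * v 1
        + Real.cos (x 2) * Ck κ₁ (x 0) / (Sk κ₁ (x 0) * Sk κ₂ (x 1)) * v 5) x v := by
  obtain ⟨hS₁, hC₁, hS₂, -⟩ := hx
  have hT : Tk κ₁ (x 0) ≠ 0 := div_ne_zero hS₁ hC₁
  refine ((((((hasDirDerivAt_Sk κ₂ 1 x v).const_mul κ₂).mul (hasDirDerivAt_sin 2 x v)).mul
      (.coord 3 x v)).add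
    ((((hasDirDerivAt_Ck κ₂ 1 x v).mul (hasDirDerivAt_sin 2 x v)).div
      (hasDirDerivAt_Tk_fst hC₁ v) hT).mul (.coord 4 x v))).add
    (((hasDirDerivAt_cos 2 x v).div
      ((hasDirDerivAt_Tk_fst hC₁ v).mul (hasDirDerivAt_Sk κ₂ 1 x v)) (mul_ne_zero hT hS₂)).mul
      (.coord 5 x v))).congr_deriv ?_
  simp only [Tk]
  field_simp
  ring

lemma hasDirDerivAt_I01 (hx : x ∈ D κ₁ κ₂) (β₀ β₁ : ℝ) {d : ℝ} {v : Pt}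
    (hJ : HasDirDerivAt (J01 κ₁ κ₂) d x v) :
    HasDirDerivAt (I01 κ₁ κ₂ β₀ β₁)
      (2 * J01 κ₁ κ₂ x * d
        + 4 * β₀ * (Sk κ₁ (x 0) * Ck κ₂ (x 1) ^ 2 / Ck κ₁ (x 0) ^ 3 * v 0
          - κ₂ * Sk κ₁ (x 0) ^ 2 * Ck κ₂ (x 1) * Sk κ₂ (x 1) / Ck κ₁ (x 0) ^ 2 * v 1)
        + 4 * β₁ * (-Ck κ₁ (x 0) / (Sk κ₁ (x 0) ^ 3 * Ck κ₂ (x 1) ^ 2) * v 0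
          + κ₂ * Ck κ₁ (x 0) ^ 2 * Sk κ₂ (x 1) / (Sk κ₁ (x 0) ^ 2 * Ck κ₂ (x 1) ^ 3) * v 1))
      x v := by
  obtain ⟨hS₁, hC₁, hS₂, hC₂, -⟩ := hx
  have hT : Tk κ₁ (x 0) ≠ 0 := div_ne_zero hS₁ hC₁
  have hT' := (hasDirDerivAt_Tk_fst hC₁ v).sq
  have hC' := (hasDirDerivAt_Ck κ₂ 1 x v).sq
  refine ((hJ.sq.add ((hT'.const_mul (2 * β₀)).mul hC')).add
    ((HasDirDerivAt.const (2 * β₁) x v).div (hT'.mul hC') (by positivity))).congr_deriv ?_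
  simp only [Tk]
  field_simp
  ring

lemma hasDirDerivAt_I02 (hx : x ∈ D κ₁ κ₂) (β₀ β₂ : ℝ) {d : ℝ} {v : Pt}
    (hJ : HasDirDerivAt (J02 κ₁ κ₂) d x v) :
    HasDirDerivAt (I02 κ₁ κ₂ β₀ β₂)
      (2 * J02 κ₁ κ₂ x * d
        + 4 * β₀ * κ₂ ^ 2 * (Sk κ₁ (x 0) * Sk κ₂ (x 1) ^ 2 * Real.cos (x 2) ^ 2
            / Ck κ₁ (x 0) ^ 3 * v 0
          + Sk κ₁ (x 0) ^ 2 * Sk κ₂ (x 1) * Ck κ₂ (x 1) * Real.cos (x 2) ^ 2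
            / Ck κ₁ (x 0) ^ 2 * v 1
          - Sk κ₁ (x 0) ^ 2 * Sk κ₂ (x 1) ^ 2 * Real.cos (x 2) * Real.sin (x 2)
            / Ck κ₁ (x 0) ^ 2 * v 2)
        + 4 * β₂ * κ₂ * (-Ck κ₁ (x 0)
            / (Sk κ₁ (x 0) ^ 3 * Sk κ₂ (x 1) ^ 2 * Real.cos (x 2) ^ 2) * v 0
          - Ck κ₁ (x 0) ^ 2 * Ck κ₂ (x 1)
            / (Sk κ₁ (x 0) ^ 2 * Sk κ₂ (x 1) ^ 3 * Real.cos (x 2) ^ 2) * v 1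
          + Ck κ₁ (x 0) ^ 2 * Real.sin (x 2)
            / (Sk κ₁ (x 0) ^ 2 * Sk κ₂ (x 1) ^ 2 * Real.cos (x 2) ^ 3) * v 2))
      x v := by
  obtain ⟨hS₁, hC₁, hS₂, hC₂, hc, hs⟩ := hx
  have hT : Tk κ₁ (x 0) ≠ 0 := div_ne_zero hS₁ hC₁
  have hT' := (hasDirDerivAt_Tk_fst hC₁ v).sq
  have hS' := (hasDirDerivAt_Sk κ₂ 1 x v).sq
  have hc' := (hasDirDerivAt_cos 2 x v).sq
  refine ((hJ.sq.add (((hT'.const_mul (2 * β₀ * κ₂ ^ 2)).mul hS').mul hc')).add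
    ((HasDirDerivAt.const (2 * β₂ * κ₂) x v).div ((hT'.mul hS').mul hc')
      (by positivity))).congr_deriv ?_
  simp only [Tk]
  field_simp
  ring

lemma hasDirDerivAt_I03 (hx : x ∈ D κ₁ κ₂) (β₀ β₃ : ℝ) {d : ℝ} {v : Pt}
    (hJ : HasDirDerivAt (J03 κ₁ κ₂) d x v) :
    HasDirDerivAt (I03 κ₁ κ₂ β₀ β₃)
      (2 * J03 κ₁ κ₂ x * d
        + 4 * β₀ * κ₂ ^ 2 * (Sk κ₁ (x 0) * Sk κ₂ (x 1) ^ 2 * Real.sin (x 2) ^ 2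
            / Ck κ₁ (x 0) ^ 3 * v 0
          + Sk κ₁ (x 0) ^ 2 * Sk κ₂ (x 1) * Ck κ₂ (x 1) * Real.sin (x 2) ^ 2
            / Ck κ₁ (x 0) ^ 2 * v 1
          + Sk κ₁ (x 0) ^ 2 * Sk κ₂ (x 1) ^ 2 * Real.cos (x 2) * Real.sin (x 2)
            / Ck κ₁ (x 0) ^ 2 * v 2)
        + 4 * β₃ * κ₂ * (-Ck κ₁ (x 0)
            / (Sk κ₁ (x 0) ^ 3 * Sk κ₂ (x 1) ^ 2 * Real.sin (x 2) ^ 2) * v 0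
          - Ck κ₁ (x 0) ^ 2 * Ck κ₂ (x 1)
            / (Sk κ₁ (x 0) ^ 2 * Sk κ₂ (x 1) ^ 3 * Real.sin (x 2) ^ 2) * v 1
          - Ck κ₁ (x 0) ^ 2 * Real.cos (x 2)
            / (Sk κ₁ (x 0) ^ 2 * Sk κ₂ (x 1) ^ 2 * Real.sin (x 2) ^ 3) * v 2))
      x v := by
  obtain ⟨hS₁, hC₁, hS₂, hC₂, hc, hs⟩ := hx
  have hT : Tk κ₁ (x 0) ≠ 0 := div_ne_zero hS₁ hC₁
  have hT' := (hasDirDerivAt_Tk_fst hC₁ v).sq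
  have hS' := (hasDirDerivAt_Sk κ₂ 1 x v).sq
  have hs' := (hasDirDerivAt_sin 2 x v).sq
  refine ((hJ.sq.add (((hT'.const_mul (2 * β₀ * κ₂ ^ 2)).mul hS').mul hs')).add
    ((HasDirDerivAt.const (2 * β₃ * κ₂) x v).div ((hT'.mul hS').mul hs')
      (by positivity))).congr_deriv ?_
  simp only [Tk]
  field_simp
  ring

lemma hasDirDerivAt_Tkin (hκ₂ : κ₂ ≠ 0) (hx : x ∈ D κ₁ κ₂) (v : Pt) :
    HasDirDerivAt (Tkin κ₁ κ₂)
      (x 3 * v 3 + x 4 / (κ₂ * Sk κ₁ (x 0) ^ 2) * v 4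
        + x 5 / (κ₂ * Sk κ₁ (x 0) ^ 2 * Sk κ₂ (x 1) ^ 2) * v 5
        - Ck κ₁ (x 0) / (κ₂ * Sk κ₁ (x 0) ^ 3) * (x 4 ^ 2 + x 5 ^ 2 / Sk κ₂ (x 1) ^ 2) * v 0
        - Ck κ₂ (x 1) / (κ₂ * Sk κ₁ (x 0) ^ 2 * Sk κ₂ (x 1) ^ 3) * x 5 ^ 2 * v 1) x v := by
  obtain ⟨hS₁, hC₁, hS₂, hC₂, -⟩ := hx
  have hS₁' := (hasDirDerivAt_Sk κ₁ 0 x v).sq.const_mul κ₂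
  refine ((((HasDirDerivAt.coord 3 x v).sq.add
    ((HasDirDerivAt.coord 4 x v).sq.div hS₁' (by positivity))).add
    ((HasDirDerivAt.coord 5 x v).sq.div (hS₁'.mul (hasDirDerivAt_Sk κ₂ 1 x v).sq)
      (by positivity))).const_mul (1 / 2)).congr_deriv ?_
  field_simp
  ring

lemma hasDirDerivAt_HSW (hx : x ∈ D κ₁ κ₂) (β₀ β₁ β₂ β₃ : ℝ) {d : ℝ} {v : Pt}
    (hT : HasDirDerivAt (Tkin κ₁ κ₂) d x v) :
    HasDirDerivAt (HSW κ₁ κ₂ β₀ β₁ β₂ β₃)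
      (d + 2 * β₀ * Sk κ₁ (x 0) / Ck κ₁ (x 0) ^ 3 * v 0
        + 2 * β₁ * (-Ck κ₁ (x 0) / (Sk κ₁ (x 0) ^ 3 * Ck κ₂ (x 1) ^ 2) * v 0
          + κ₂ * Sk κ₂ (x 1) / (Sk κ₁ (x 0) ^ 2 * Ck κ₂ (x 1) ^ 3) * v 1)
        + 2 * β₂ * (-Ck κ₁ (x 0) / (Sk κ₁ (x 0) ^ 3 * Sk κ₂ (x 1) ^ 2 * Real.cos (x 2) ^ 2) * v 0
          - Ck κ₂ (x 1) / (Sk κ₁ (x 0) ^ 2 * Sk κ₂ (x 1) ^ 3 * Real.cos (x 2) ^ 2) * v 1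
          + Real.sin (x 2) / (Sk κ₁ (x 0) ^ 2 * Sk κ₂ (x 1) ^ 2 * Real.cos (x 2) ^ 3) * v 2)
        + 2 * β₃ * (-Ck κ₁ (x 0) / (Sk κ₁ (x 0) ^ 3 * Sk κ₂ (x 1) ^ 2 * Real.sin (x 2) ^ 2) * v 0
          - Ck κ₂ (x 1) / (Sk κ₁ (x 0) ^ 2 * Sk κ₂ (x 1) ^ 3 * Real.sin (x 2) ^ 2) * v 1
          - Real.cos (x 2) / (Sk κ₁ (x 0) ^ 2 * Sk κ₂ (x 1) ^ 2 * Real.sin (x 2) ^ 3) * v 2))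
      x v := by
  obtain ⟨hS₁, hC₁, hS₂, hC₂, hc, hs⟩ := hx
  have hS₂' := (hasDirDerivAt_Sk κ₂ 1 x v).sq
  refine ((hT.add ((hasDirDerivAt_Tk_fst hC₁ v).sq.const_mul β₀)).add
    (((HasDirDerivAt.const 1 x v).div (hasDirDerivAt_Sk κ₁ 0 x v).sq (by positivity)).mul
      ((((HasDirDerivAt.const β₁ x v).div (hasDirDerivAt_Ck κ₂ 1 x v).sq (by positivity)).add
        ((HasDirDerivAt.const β₂ x v).div (hS₂'.mul (hasDirDerivAt_cos 2 x v).sq)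
          (by positivity))).add
        ((HasDirDerivAt.const β₃ x v).div (hS₂'.mul (hasDirDerivAt_sin 2 x v).sq)
          (by positivity))))).congr_deriv ?_
  simp only [Tk]
  field_simp
  ring

end partials

/-- each of I₀₁, I₀₂, I₀₃ Poisson commutes with the
Smorodinsky–Winternitz Hamiltonian H^SW at every point of D. -/
theorem SW_extra_integrals_commute (κ₁ κ₂ : ℝ) (hκ₂ : κ₂ ≠ 0) (β₀ β₁ β₂ β₃ : ℝ) :
    ∀ x ∈ D κ₁ κ₂,
      pb (I01 κ₁ κ₂ β₀ β₁) (HSW κ₁ κ₂ β₀ β₁ β₂ β₃) x = 0 ∧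
      pb (I02 κ₁ κ₂ β₀ β₂) (HSW κ₁ κ₂ β₀ β₁ β₂ β₃) x = 0 ∧
      pb (I03 κ₁ κ₂ β₀ β₃) (HSW κ₁ κ₂ β₀ β₁ β₂ β₃) x = 0 := by
  intro x hx
  have hH i := (hasDirDerivAt_HSW hx β₀ β₁ β₂ β₃
    (hasDirDerivAt_Tkin hκ₂ hx (Pi.single i 1))).pd_eq
  have h1 i := (hasDirDerivAt_I01 hx β₀ β₁ (hasDirDerivAt_J01 hx (Pi.single i 1))).pd_eq
  have h2 i := (hasDirDerivAt_I02 hx β₀ β₂ (hasDirDerivAt_J02 hx (Pi.single i 1))).pd_eq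
  have h3 i := (hasDirDerivAt_I03 hx β₀ β₃ (hasDirDerivAt_J03 hx (Pi.single i 1))).pd_eq
  obtain ⟨hS₁, hC₁, hS₂, hC₂, hc, hs⟩ := hx
  have hκ : κ₂ = (1 - Ck κ₂ (x 1) ^ 2) / Sk κ₂ (x 1) ^ 2 := by
    field_simp
    linarith [Ck_sq_add_Sk_sq κ₂ (x 1)]
  have hφ := Real.sin_sq_add_cos_sq (x 2)
  refine ⟨?_, ?_, ?_⟩
  · simp only [pb, Fin.sum_univ_three, h1, hH, J01, Tk]
    simp [Fin.ext_iff]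
    clear hH h1 h2 h3
    generalize Sk κ₁ (x 0) = S at *
    generalize Ck κ₁ (x 0) = C at *
    generalize Sk κ₂ (x 1) = s at *
    generalize Ck κ₂ (x 1) = c at *
    generalize Real.sin (x 2) = sinφ at *
    generalize Real.cos (x 2) = cosφ at *
    field_simp
    rw [hκ]
    field_simp
    ring
  · simp only [pb, Fin.sum_univ_three, h2, hH, J02, Tk]
    simp [Fin.ext_iff]
    clear hH h1 h2 h3
    generalize Sk κ₁ (x 0) = S at *
    generalize Ck κ₁ (x 0) = C at *
    generalize Sk κ₂ (x 1) = s at *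
    generalize Ck κ₂ (x 1) = c at *
    generalize Real.sin (x 2) = sinφ at *
    generalize Real.cos (x 2) = cosφ at *
    field_simp
    rw [hκ]
    field_simp
    grind
  · simp only [pb, Fin.sum_univ_three, h3, hH, J03, Tk]
    simp [Fin.ext_iff]
    clear hH h1 h2 h3
    generalize Sk κ₁ (x 0) = S at *
    generalize Ck κ₁ (x 0) = C at *
    generalize Sk κ₂ (x 1) = s at *
    generalize Ck κ₂ (x 1) = c at *
    generalize Real.sin (x 2) = sinφ at *
    generalize Real.cos (x 2) = cosφ at *
    field_simp
    rw [hκ]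
    field_simp
    grind

end
end Paper
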